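/- Let N ≥ 3 and let α be a real number with 0 ≤ α < N − 2. Then for every u ∈ C_c^∞(ℍ^N∖{o}) one has ∫_{ℍ^N} |∇_r u|²/r^α dv ≥ ((N−2−α)²/4) ∫_{ℍ^N} u²/r^{α+2} dv + ((N−1)/4) ∫_{ℍ^N} u²/r^α dv. -/

import Mathlib

open MeasureTheory Real Set

noncomputable section

/-- The radial derivative `∇_r u = ∂u/∂r` of a function `u(r,σ)`. -/
def radGrad (N : ℕ) (u : ℝ → EuclideanSpace ℝ (Fin N) → ℝ) :
    ℝ → EuclideanSpace ℝ (Fin N) → ℝ :=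
  fun r σ => deriv (fun s => u s σ) r

/-- The radial Laplacian `Δ_r u = ∂²u/∂r² + (N-1) coth r · ∂u/∂r`. -/
def radLap (N : ℕ) (u : ℝ → EuclideanSpace ℝ (Fin N) → ℝ) :
    ℝ → EuclideanSpace ℝ (Fin N) → ℝ :=
  fun r σ => deriv (fun s => deriv (fun t => u t σ) s) r
    + ((N : ℝ) - 1) * (Real.cosh r / Real.sinh r) * deriv (fun s => u s σ) r

/-- The higher order radial derivative `∇_r^k u`: `Δ_r^{k/2} u` for even `k`,
`∂_r (Δ_r^{(k-1)/2} u)` for odd `k`. -/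
def radPow (N k : ℕ) (u : ℝ → EuclideanSpace ℝ (Fin N) → ℝ) :
    ℝ → EuclideanSpace ℝ (Fin N) → ℝ :=
  if Even k then (radLap N)^[k / 2] u else radGrad N ((radLap N)^[k / 2] u)

/-- The integral over the hyperbolic space `ℍ^N` in polar coordinates:
`∫_{S^{N-1}} ∫_0^∞ F(r,σ) (sinh r)^{N-1} dr dσ`, where `dσ` is the standard
surface measure (the `(N-1)`-dimensional Hausdorff measure) on the unit sphere. -/
def hypInt (N : ℕ) (F : ℝ → EuclideanSpace ℝ (Fin N) → ℝ) : ℝ :=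
  ∫ σ in Metric.sphere (0 : EuclideanSpace ℝ (Fin N)) 1,
    (∫ r in Ioi (0 : ℝ), F r σ * Real.sinh r ^ (N - 1)) ∂μH[(N : ℝ) - 1]

/-- `u ∈ C_c^∞(ℍ^N)`: `u(r,σ)` smooth (including at the pole `r = 0`) and
vanishing for all `r` larger than some `R`. -/
def IsCc (N : ℕ) (u : ℝ → EuclideanSpace ℝ (Fin N) → ℝ) : Prop :=
  ContDiff ℝ (⊤ : ℕ∞) (Function.uncurry u) ∧
  ∃ R : ℝ, ∀ r : ℝ, R < r → ∀ σ ∈ Metric.sphere (0 : EuclideanSpace ℝ (Fin N)) 1, u r σ = 0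

/-- `u ∈ C_c^∞(ℍ^N \ {o})`: `u(r,σ)` smooth with support contained in
`[a,b] × S^{N-1}` for some `0 < a ≤ b`. -/
def IsCcAway (N : ℕ) (u : ℝ → EuclideanSpace ℝ (Fin N) → ℝ) : Prop :=
  ContDiff ℝ (⊤ : ℕ∞) (Function.uncurry u) ∧
  ∃ a b : ℝ, 0 < a ∧ a ≤ b ∧
    ∀ r : ℝ, r ∉ Icc a b → ∀ σ ∈ Metric.sphere (0 : EuclideanSpace ℝ (Fin N)) 1, u r σ = 0

lemma nonneg_of_hasDerivAt_nonneg {f f' : ℝ → ℝ} (h0 : f 0 = 0)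
    (hf : ∀ x, HasDerivAt f (f' x) x) (hf' : ∀ x, 0 ≤ x → 0 ≤ f' x) {x : ℝ} (hx : 0 ≤ x) :
    0 ≤ f x := by
  have hm : MonotoneOn f (Ici 0) := by
    refine monotoneOn_of_deriv_nonneg (convex_Ici 0)
      (fun y _ => (hf y).continuousAt.continuousWithinAt)
      (fun y _ => (hf y).differentiableAt.differentiableWithinAt) fun y hy => ?_
    rw [(hf y).deriv]
    rw [interior_Ici] at hy
    exact hf' y (le_of_lt hy)
  exact h0 ▸ hm self_mem_Ici hx hx

lemma sinh_le_mul_cosh {x : ℝ} (hx : 0 ≤ x) : sinh x ≤ x * cosh x := by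
  have := nonneg_of_hasDerivAt_nonneg (f := fun x => x * cosh x - sinh x)
    (f' := fun x => x * sinh x) (by simp)
    (fun x => by
      have h := ((hasDerivAt_id x).mul (hasDerivAt_cosh x)).sub (hasDerivAt_sinh x)
      refine h.congr_deriv ?_
      simp)
    (fun x hx => mul_nonneg hx (sinh_nonneg_iff.2 hx)) hx
  linarith

lemma three_mul_mul_cosh_le {x : ℝ} (hx : 0 ≤ x) : 3 * (x * cosh x) ≤ (3 + x ^ 2) * sinh x := by
  have := nonneg_of_hasDerivAt_nonneg (f := fun x => (3 + x ^ 2) * sinh x - 3 * (x * cosh x))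
    (f' := fun x => x * (x * cosh x - sinh x)) (by simp)
    (fun x => by
      have h := (((hasDerivAt_pow 2 x).const_add 3).mul (hasDerivAt_sinh x)).sub
        (((hasDerivAt_id x).mul (hasDerivAt_cosh x)).const_mul 3)
      refine h.congr_deriv ?_
      simp; ring)
    (fun x hx => mul_nonneg hx (sub_nonneg.2 (sinh_le_mul_cosh hx))) hx
  linarith

lemma sinh_sq_mul_le {x : ℝ} (hx : 0 ≤ x) : sinh x ^ 2 * (3 - x ^ 2) ≤ 3 * x ^ 2 := by
  have h3 : ∀ x : ℝ, 0 ≤ x → 0 ≤ 10 + 4 * (x * sinh x) + (x ^ 2 - 10) * cosh x := fun x hx =>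
    nonneg_of_hasDerivAt_nonneg
      (f := fun x => 10 + 4 * (x * sinh x) + (x ^ 2 - 10) * cosh x)
      (f' := fun x => 6 * (x * cosh x - sinh x) + x ^ 2 * sinh x) (by simp)
      (fun x => by
        have h := ((((hasDerivAt_id x).mul (hasDerivAt_sinh x)).const_mul 4).const_add 10).add
          (((hasDerivAt_pow 2 x).sub_const 10).mul (hasDerivAt_cosh x))
        refine h.congr_deriv ?_
        simp; ring)
      (fun x hx => add_nonneg (mul_nonneg (by norm_num) (sub_nonneg.2 (sinh_le_mul_cosh hx)))
        (mul_nonneg (sq_nonneg x) (sinh_nonneg_iff.2 hx))) hx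
  have h2 : ∀ x : ℝ, 0 ≤ x → 0 ≤ 10 * x + 2 * (x * cosh x) + (x ^ 2 - 12) * sinh x := fun x hx =>
    nonneg_of_hasDerivAt_nonneg
      (f := fun x => 10 * x + 2 * (x * cosh x) + (x ^ 2 - 12) * sinh x)
      (f' := fun x => 10 + 4 * (x * sinh x) + (x ^ 2 - 10) * cosh x) (by simp)
      (fun x => by
        have h := (((hasDerivAt_id x).const_mul 10).add
          (((hasDerivAt_id x).mul (hasDerivAt_cosh x)).const_mul 2)).add
          (((hasDerivAt_pow 2 x).sub_const 12).mul (hasDerivAt_sinh x))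
        refine h.congr_deriv ?_
        simp; ring)
      h3 hx
  have h1 : ∀ x : ℝ, 0 ≤ x → 0 ≤ 5 * x ^ 2 + 12 + (x ^ 2 - 12) * cosh x := fun x hx =>
    nonneg_of_hasDerivAt_nonneg
      (f := fun x => 5 * x ^ 2 + 12 + (x ^ 2 - 12) * cosh x)
      (f' := fun x => 10 * x + 2 * (x * cosh x) + (x ^ 2 - 12) * sinh x) (by simp)
      (fun x => by
        have h := (((hasDerivAt_pow 2 x).const_mul 5).add_const 12).add
          (((hasDerivAt_pow 2 x).sub_const 12).mul (hasDerivAt_cosh x))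
        refine h.congr_deriv ?_
        simp; ring)
      h2 hx
  have h := h1 (2 * x) (by linarith)
  rw [cosh_two_mul, cosh_sq] at h
  nlinarith

/-- The Riccati-type inequality satisfied by `g = -(n/2) coth r + (1+α)/(2r)`. -/
lemma riccati_le_zero {n : ℝ} (hn : 2 ≤ n) {α : ℝ} (hα0 : 0 ≤ α) (hα : α < n - 1)
    {r : ℝ} (hr : 0 < r) :
    (n / 2 / sinh r ^ 2 - (1 + α) / 2 / r ^ 2)
      + (-(n / 2) * (cosh r / sinh r) + (1 + α) / 2 / r) * (n * (cosh r / sinh r) - α / r)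
      + (-(n / 2) * (cosh r / sinh r) + (1 + α) / 2 / r) ^ 2
      + (n - 1 - α) ^ 2 / 4 / r ^ 2 + n / 4 ≤ 0 := by
  have hs : 0 < sinh r := sinh_pos_iff.2 hr
  have hq : 1 / r ^ 2 - 1 / 3 ≤ 1 / sinh r ^ 2 := by
    have := sinh_sq_mul_le hr.le
    rw [div_sub_div _ _ (by positivity) (by norm_num), div_le_div_iff₀ (by positivity) (by positivity)]
    nlinarith
  have hc : cosh r / sinh r / r ≤ 1 / r ^ 2 + 1 / 3 := by
    have := three_mul_mul_cosh_le hr.le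
    rw [div_add_div _ _ (by positivity) (by norm_num), div_div,
      div_le_div_iff₀ (by positivity) (by positivity)]
    nlinarith
  have hcs : (cosh r / sinh r) ^ 2 = 1 + 1 / sinh r ^ 2 := by
    rw [div_pow, cosh_sq]; field_simp
  have key : n * (n - 2) / 4 * (1 / r ^ 2 - 1 / 3) ≤ n * (n - 2) / 4 * (1 / sinh r ^ 2) :=
    mul_le_mul_of_nonneg_left hq (by nlinarith)
  have key2 : n * α / 2 * (cosh r / sinh r / r) ≤ n * α / 2 * (1 / r ^ 2 + 1 / 3) :=
    mul_le_mul_of_nonneg_left hc (by positivity)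
  have e : (n / 2 / sinh r ^ 2 - (1 + α) / 2 / r ^ 2)
      + (-(n / 2) * (cosh r / sinh r) + (1 + α) / 2 / r) * (n * (cosh r / sinh r) - α / r)
      + (-(n / 2) * (cosh r / sinh r) + (1 + α) / 2 / r) ^ 2
      + (n - 1 - α) ^ 2 / 4 / r ^ 2 + n / 4
      = n / 2 * (1 / sinh r ^ 2) - n ^ 2 / 4 * (cosh r / sinh r) ^ 2
        + n * α / 2 * (cosh r / sinh r / r)
        + ((n - 1 - α) ^ 2 / 4 - (1 + α) ^ 2 / 4) * (1 / r ^ 2) + n / 4 := by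
    field_simp; ring
  rw [e, hcs]
  nlinarith

lemma interval_hardy {n : ℕ} (hn : 2 ≤ n) {α : ℝ} (hα0 : 0 ≤ α) (hα : α < (n : ℝ) - 1)
    {A B : ℝ} (hA : 0 < A) (hAB : A ≤ B) {v v' : ℝ → ℝ} (hv : ∀ r, HasDerivAt v (v' r) r)
    (hv' : Continuous v') (hvA : v A = 0) (hvB : v B = 0) :
    ((n : ℝ) - 1 - α) ^ 2 / 4 * (∫ r in A..B, v r ^ 2 / r ^ (α + 2) * sinh r ^ n)
      + (n : ℝ) / 4 * (∫ r in A..B, v r ^ 2 / r ^ α * sinh r ^ n)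
      ≤ ∫ r in A..B, v' r ^ 2 / r ^ α * sinh r ^ n := by
  have hvc : Continuous v := continuous_iff_continuousAt.2 fun r => (hv r).continuousAt
  have hpos : ∀ r ∈ uIcc A B, 0 < r := fun r hr => by
    rw [uIcc_of_le hAB] at hr; exact hA.trans_le hr.1
  have hint : ∀ {f : ℝ → ℝ} (_ : Continuous f) (β : ℝ),
      IntervalIntegrable (fun r => f r / r ^ β * sinh r ^ n) volume A B := by
    intro f hf β
    refine ContinuousOn.intervalIntegrable fun r hr => ?_
    have h := hpos r hr
    exact ((hf.continuousAt.div (continuousAt_id.rpow_const (Or.inl h.ne'))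
      (rpow_pos_of_pos h β).ne').mul (continuous_sinh.continuousAt.pow n)).continuousWithinAt
  set g : ℝ → ℝ := fun r => -((n : ℝ) / 2) * (cosh r / sinh r) + (1 + α) / 2 / r with hg
  set g' : ℝ → ℝ := fun r => (n : ℝ) / 2 / sinh r ^ 2 - (1 + α) / 2 / r ^ 2 with hg'
  set W : ℝ → ℝ := fun r => sinh r ^ n / r ^ α with hW
  set W' : ℝ → ℝ := fun r => W r * (n * (cosh r / sinh r) - α / r) with hW'
  set P' : ℝ → ℝ := fun r => (g' r * W r + g r * W' r) * v r ^ 2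
    + g r * W r * (2 * v r * v' r) with hP'
  have hgd : ∀ r, 0 < r → HasDerivAt g (g' r) r := fun r hr => by
    have hs : 0 < sinh r := sinh_pos_iff.2 hr
    have h := (((hasDerivAt_cosh r).div (hasDerivAt_sinh r) hs.ne').const_mul (-((n : ℝ) / 2))).add
      ((hasDerivAt_inv hr.ne').const_mul ((1 + α) / 2))
    refine h.congr_deriv ?_
    simp only [hg']
    have : sinh r * sinh r - cosh r * cosh r = -1 := by
      have := cosh_sq r; nlinarith
    rw [this]; field_simp; ring
  have hWd : ∀ r, 0 < r → HasDerivAt W (W' r) r := fun r hr => by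
    have hs : 0 < sinh r := sinh_pos_iff.2 hr
    have hp : 0 < r ^ α := rpow_pos_of_pos hr α
    have h := ((hasDerivAt_sinh r).pow n).div (hasDerivAt_rpow_const (p := α) (Or.inl hr.ne')) hp.ne'
    refine h.congr_deriv ?_
    simp only [hW', hW]
    obtain ⟨m, rfl⟩ : ∃ m, n = m + 1 := ⟨n - 1, by omega⟩
    rw [rpow_sub_one hr.ne', Nat.add_sub_cancel, Pi.pow_apply]
    field_simp
    ring
  have hPd : ∀ r ∈ uIcc A B, HasDerivAt (fun r => g r * W r * v r ^ 2) (P' r) r := fun r hr => by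
    have h := ((hgd r (hpos r hr)).mul (hWd r (hpos r hr))).mul ((hv r).pow 2)
    refine h.congr_deriv ?_
    simp [hP']
  have hP'i : IntervalIntegrable P' volume A B := by
    refine ContinuousOn.intervalIntegrable fun r hr => ?_
    have h := hpos r hr
    have hs : sinh r ≠ 0 := (sinh_pos_iff.2 h).ne'
    have c1 : ContinuousAt g r := (hgd r h).continuousAt
    have c2 : ContinuousAt W r := (hWd r h).continuousAt
    have c3 : ContinuousAt g' r := by
      refine (continuousAt_const.div (continuous_sinh.continuousAt.pow 2) (pow_ne_zero 2 hs)).sub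
        (continuousAt_const.div (continuousAt_id.pow 2) ?_)
      simpa using h.ne'
    have c4 : ContinuousAt W' r := c2.mul ((continuousAt_const.mul
      (continuous_cosh.continuousAt.div continuous_sinh.continuousAt hs)).sub
      (continuousAt_const.div continuousAt_id h.ne'))
    have c5 := hvc.continuousAt (x := r)
    have c6 := hv'.continuousAt (x := r)
    exact ((((c3.mul c2).add (c1.mul c4)).mul (c5.pow 2)).add
      ((c1.mul c2).mul ((continuousAt_const.mul c5).mul c6))).continuousWithinAt
  have hP0 : ∫ r in A..B, P' r = 0 := by
    rw [intervalIntegral.integral_eq_sub_of_hasDerivAt hPd hP'i]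
    simp [hvA, hvB]
  have i1 := (hint (hvc.pow 2) (α + 2)).const_mul (((n : ℝ) - 1 - α) ^ 2 / 4)
  have i2 := (hint (hvc.pow 2) α).const_mul ((n : ℝ) / 4)
  have hmono := intervalIntegral.integral_mono_on hAB ((hP'i.add i1).add i2)
    (hint (hv'.pow 2) α) fun r hr => by
      have h : 0 < r := hA.trans_le hr.1
      have hs : 0 < sinh r := sinh_pos_iff.2 h
      have hp : 0 < r ^ α := rpow_pos_of_pos h α
      have hWp : 0 < W r := by simp only [hW]; positivity
      have hR := riccati_le_zero (n := n) (by exact_mod_cast hn) hα0 hα h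
      have e1 : v r ^ 2 / r ^ (α + 2) * sinh r ^ n = W r * (v r ^ 2 / r ^ 2) := by
        rw [rpow_add h, rpow_two]; simp only [hW]; field_simp
      have e2 : v r ^ 2 / r ^ α * sinh r ^ n = W r * v r ^ 2 := by simp only [hW]; ring
      have e3 : v' r ^ 2 / r ^ α * sinh r ^ n = W r * v' r ^ 2 := by simp only [hW]; ring
      simp only [Pi.pow_apply]
      rw [e1, e2, e3]
      change g' r + g r * (n * (cosh r / sinh r) - α / r) + g r ^ 2
        + ((n : ℝ) - 1 - α) ^ 2 / 4 / r ^ 2 + n / 4 ≤ 0 at hR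
      have key := mul_nonneg hWp.le (add_nonneg (sq_nonneg (v' r - g r * v r))
        (mul_nonneg (sq_nonneg (v r)) (neg_nonneg.2 hR)))
      simp only [hP', hW']
      have e4 : v r ^ 2 / r ^ 2 = v r ^ 2 * (1 / r ^ 2) := by ring
      have e5 : ((n : ℝ) - 1 - α) ^ 2 / 4 / r ^ 2 = ((n : ℝ) - 1 - α) ^ 2 / 4 * (1 / r ^ 2) := by
        ring
      rw [e4]; rw [e5] at key
      linarith
  rw [intervalIntegral.integral_add (hP'i.add i1) i2, intervalIntegral.integral_add hP'i i1, hP0,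
    intervalIntegral.integral_const_mul, intervalIntegral.integral_const_mul] at hmono
  simpa using hmono

lemma hausdorffMeasure_sphere_lt_top (m : ℕ) :
    μH[(m : ℝ)] (Metric.sphere (0 : EuclideanSpace ℝ (Fin (m + 1))) 1) < ⊤ := by
  let z : Fin (m + 1) → ℝ → (Fin m → ℝ) → EuclideanSpace ℝ (Fin (m + 1)) :=
    fun i e y => WithLp.toLp 2 (i.insertNth e y)
  have hz0 : ∀ i e y, e ≠ 0 → z i e y ≠ 0 := fun i e y he h => he <| by
    simpa [z] using congrArg (fun w : EuclideanSpace ℝ (Fin (m + 1)) => w i) h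
  have hzs : ∀ i e, ContDiff ℝ 1 (z i e) := fun i e => by
    rw [contDiff_euclidean]
    intro j
    rcases Fin.eq_self_or_eq_succAbove i j with rfl | ⟨k, rfl⟩
    · simpa [z] using contDiff_const
    · simpa [z] using contDiff_apply ℝ ℝ k
  let F : Fin (m + 1) → ℝ → (Fin m → ℝ) → EuclideanSpace ℝ (Fin (m + 1)) :=
    fun i e y => ‖z i e y‖⁻¹ • z i e y
  have hF : ∀ i e, e ≠ 0 → μH[(m : ℝ)] (F i e '' Metric.closedBall 0 1) < ⊤ := fun i e he => by
    have hd : ContDiff ℝ 1 (F i e) :=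
      (((hzs i e).norm ℝ fun y => hz0 i e y he).inv
        fun y => norm_ne_zero_iff.2 (hz0 i e y he)).smul (hzs i e)
    obtain ⟨K, hK⟩ := hd.contDiffOn.exists_lipschitzOnWith one_ne_zero
      (convex_closedBall (0 : Fin m → ℝ) 1) (isCompact_closedBall 0 1)
    refine (hK.hausdorffMeasure_image_le (Nat.cast_nonneg m)).trans_lt
      (ENNReal.mul_lt_top (ENNReal.rpow_lt_top_of_nonneg (Nat.cast_nonneg m) ENNReal.coe_ne_top) ?_)
    have := hausdorffMeasure_pi_real (ι := Fin m)
    rw [Fintype.card_fin] at this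
    rw [this]
    exact (isCompact_closedBall 0 1).measure_lt_top
  have hcover : Metric.sphere (0 : EuclideanSpace ℝ (Fin (m + 1))) 1 ⊆
      ⋃ i : Fin (m + 1), (F i 1 '' Metric.closedBall 0 1 ∪ F i (-1) '' Metric.closedBall 0 1) := by
    intro x hx
    have hx1 : ‖x‖ = 1 := by simpa using hx
    obtain ⟨i, -, hi⟩ := Finset.exists_max_image Finset.univ (fun j => |x j|) Finset.univ_nonempty
    have hpos : 0 < |x i| := by
      by_contra! h
      have : x = 0 := by
        ext j
        exact abs_nonpos_iff.1 ((hi j (Finset.mem_univ j)).trans h)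
      simp [this] at hx1
    have hxe : ∀ e : ℝ, x i = |x i| * e → F i e (fun j => |x i|⁻¹ * x (i.succAbove j)) = x := by
      intro e he
      have hze : z i e (fun j => |x i|⁻¹ * x (i.succAbove j)) = |x i|⁻¹ • x := by
        ext j
        rcases Fin.eq_self_or_eq_succAbove i j with rfl | ⟨k, rfl⟩
        · simp only [z, Fin.insertNth_apply_same, PiLp.smul_apply, smul_eq_mul]
          rw [eq_inv_mul_iff_mul_eq₀ hpos.ne', ← he]
        · simp [z]
      simp only [F, hze, norm_smul, hx1, smul_smul]
      simp [hpos.ne']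
    have hmem : (fun j => |x i|⁻¹ * x (i.succAbove j)) ∈ Metric.closedBall (0 : Fin m → ℝ) 1 := by
      rw [mem_closedBall_zero_iff, pi_norm_le_iff_of_nonneg zero_le_one]
      intro j
      rw [norm_mul, norm_inv, Real.norm_eq_abs, abs_abs, Real.norm_eq_abs,
        inv_mul_le_iff₀ hpos, mul_one]
      exact hi _ (Finset.mem_univ _)
    refine mem_iUnion.2 ⟨i, ?_⟩
    rcases le_total 0 (x i) with h | h
    · exact Or.inl ⟨_, hmem, hxe 1 (by rw [abs_of_nonneg h, mul_one])⟩
    · exact Or.inr ⟨_, hmem, hxe (-1) (by rw [abs_of_nonpos h]; ring)⟩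
  refine (measure_mono hcover).trans_lt ((measure_iUnion_fintype_le _ _).trans_lt ?_)
  exact ENNReal.sum_lt_top.2 fun i _ => measure_union_lt_top
    (hF i 1 one_ne_zero) (hF i (-1) (by norm_num))

lemma integrableOn_sphere_radial_integral {m : ℕ} {f : ℝ → EuclideanSpace ℝ (Fin (m + 1)) → ℝ}
    (hf : Continuous (Function.uncurry f)) (β : ℝ) (k : ℕ) {A B : ℝ} (hA : 0 < A) (hAB : A ≤ B) :
    IntegrableOn (fun σ => ∫ r in A..B, f r σ / r ^ β * sinh r ^ k)
      (Metric.sphere (0 : EuclideanSpace ℝ (Fin (m + 1))) 1) μH[(m : ℝ)] := by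
  have hc : Continuous fun σ => ∫ r in A..B, f r σ / r ^ β * sinh r ^ k := by
    have h : (fun σ => ∫ r in A..B, f r σ / r ^ β * sinh r ^ k)
        = fun σ => ∫ r in A..B, f r σ / (max r A) ^ β * sinh r ^ k := by
      funext σ
      refine intervalIntegral.integral_congr fun r hr => ?_
      rw [uIcc_of_le hAB] at hr
      simp only [max_eq_left hr.1]
    rw [h]
    refine intervalIntegral.continuous_parametric_intervalIntegral_of_continuous' ?_ A B
    have hmax : ∀ r : ℝ, 0 < max r A := fun r => lt_max_of_lt_right hA
    refine Continuous.mul (Continuous.div (hf.comp continuous_swap) ?_ fun p =>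
      (rpow_pos_of_pos (hmax p.2) β).ne') ((continuous_sinh.comp continuous_snd).pow k)
    exact (continuous_snd.max continuous_const).rpow_const fun p => Or.inl (hmax p.2).ne'
  obtain ⟨M, hM⟩ :=
    (isCompact_sphere (0 : EuclideanSpace ℝ (Fin (m + 1))) 1).exists_bound_of_continuousOn
      hc.continuousOn
  exact Measure.integrableOn_of_bounded (hausdorffMeasure_sphere_lt_top m).ne
    hc.aestronglyMeasurable
    ((ae_restrict_iff' Metric.isClosed_sphere.measurableSet).2 (Filter.Eventually.of_forall hM))

lemma hypInt_eq_intervalIntegral {m : ℕ} {f : ℝ → EuclideanSpace ℝ (Fin (m + 1)) → ℝ}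
    {A B : ℝ} (hA : 0 < A) (hAB : A ≤ B)
    (hf : ∀ σ ∈ Metric.sphere (0 : EuclideanSpace ℝ (Fin (m + 1))) 1, ∀ r ∉ Ioc A B, f r σ = 0)
    (β : ℝ) :
    hypInt (m + 1) (fun r σ => f r σ / r ^ β)
      = ∫ σ in Metric.sphere (0 : EuclideanSpace ℝ (Fin (m + 1))) 1,
          (∫ r in A..B, f r σ / r ^ β * sinh r ^ m) ∂μH[(m : ℝ)] := by
  have hm : (((m + 1 : ℕ) : ℝ) - 1) = m := by push_cast; ring
  rw [hypInt, hm, Nat.add_sub_cancel]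
  refine setIntegral_congr_fun Metric.isClosed_sphere.measurableSet fun σ hσ => ?_
  rw [intervalIntegral.integral_of_le hAB]
  refine setIntegral_eq_of_subset_of_forall_sdiff_eq_zero measurableSet_Ioi
    (fun r hr => hA.trans hr.1) fun r hr => ?_
  rw [hf σ hσ r hr.2, zero_div, zero_mul]

/-- Weighted Hardy inequality with radial derivative on `ℍ^N` for `0 ≤ α < N-2`. -/
theorem weighted_radial_hardy' (N : ℕ) (hN : 3 ≤ N) (α : ℝ)
    (hα0 : 0 ≤ α) (hα : α < (N : ℝ) - 2)
    (u : ℝ → EuclideanSpace ℝ (Fin N) → ℝ) (hu : IsCcAway N u) :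
    hypInt N (fun r σ => (radGrad N u r σ) ^ 2 / r ^ α) ≥
      (((N : ℝ) - 2 - α) ^ 2 / 4) * hypInt N (fun r σ => (u r σ) ^ 2 / r ^ (α + 2))
      + (((N : ℝ) - 1) / 4) * hypInt N (fun r σ => (u r σ) ^ 2 / r ^ α) := by
  obtain ⟨m, rfl⟩ : ∃ m, N = m + 1 := ⟨N - 1, by omega⟩
  obtain ⟨hsm, a, b, ha, hab, hsupp⟩ := hu
  have hA : 0 < a / 2 := by linarith
  have hAB : a / 2 ≤ b + 1 := by linarith
  have hd : ∀ σ r, HasDerivAt (fun s => u s σ) (fderiv ℝ (Function.uncurry u) (r, σ) (1, 0)) r :=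
    fun σ r => by
      have h : HasDerivAt (fun s : ℝ => (s, σ)) (1, 0) r :=
        (hasDerivAt_id r).prodMk (hasDerivAt_const r σ)
      have hfd := (hsm.differentiable (by simp) (r, σ)).hasFDerivAt
      exact hfd.comp_hasDerivAt r h
  have hgrad : ∀ r σ, radGrad (m + 1) u r σ = fderiv ℝ (Function.uncurry u) (r, σ) (1, 0) :=
    fun r σ => (hd σ r).deriv
  have hgc : Continuous (Function.uncurry (radGrad (m + 1) u)) := by
    have : Function.uncurry (radGrad (m + 1) u)
        = fun p => fderiv ℝ (Function.uncurry u) p (1, 0) := by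
      funext p; exact hgrad p.1 p.2
    rw [this]
    exact (hsm.continuous_fderiv (by simp)).clm_apply continuous_const
  have hnot : ∀ r ∉ Ioc (a / 2) (b + 1), r ∉ Icc a b := fun r hr h =>
    hr ⟨by linarith [h.1], by linarith [h.2]⟩
  have hu0 : ∀ σ ∈ Metric.sphere (0 : EuclideanSpace ℝ (Fin (m + 1))) 1,
      ∀ r ∉ Ioc (a / 2) (b + 1), u r σ ^ 2 = 0 := fun σ hσ r hr => by
    rw [hsupp r (hnot r hr) σ hσ, zero_pow two_ne_zero]
  have hg0 : ∀ σ ∈ Metric.sphere (0 : EuclideanSpace ℝ (Fin (m + 1))) 1,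
      ∀ r ∉ Ioc (a / 2) (b + 1), radGrad (m + 1) u r σ ^ 2 = 0 := fun σ hσ r hr => by
    have : (fun s => u s σ) =ᶠ[nhds r] fun _ => 0 := by
      filter_upwards [isClosed_Icc.isOpen_compl.mem_nhds (hnot r hr)] with s hs
      exact hsupp s hs σ hσ
    rw [radGrad, this.deriv_eq, deriv_const, zero_pow two_ne_zero]
  have hu2 : Continuous (Function.uncurry fun r σ => u r σ ^ 2) := hsm.continuous.pow 2
  have hg2 : Continuous (Function.uncurry fun r σ => radGrad (m + 1) u r σ ^ 2) := hgc.pow 2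
  have i0 := integrableOn_sphere_radial_integral hg2 α m hA hAB
  have i1 := (integrableOn_sphere_radial_integral hu2 (α + 2) m hA hAB).const_mul
    (((m : ℝ) - 1 - α) ^ 2 / 4)
  have i2 := (integrableOn_sphere_radial_integral hu2 α m hA hAB).const_mul ((m : ℝ) / 4)
  have hm1 : ((m + 1 : ℕ) : ℝ) - 1 = m := by push_cast; ring
  have hm2 : ((m + 1 : ℕ) : ℝ) - 2 = m - 1 := by push_cast; ring
  rw [hm2] at hα
  rw [hypInt_eq_intervalIntegral hA hAB hg0, hypInt_eq_intervalIntegral hA hAB hu0,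
    hypInt_eq_intervalIntegral hA hAB hu0, hm1, hm2, ← integral_const_mul, ← integral_const_mul,
    ← integral_add i1 i2]
  refine setIntegral_mono_on (i1.add i2) i0 Metric.isClosed_sphere.measurableSet fun σ hσ => ?_
  refine interval_hardy (v := fun r => u r σ) (v' := fun r => radGrad (m + 1) u r σ)
    (by omega) hα0 hα hA hAB (fun r => (hgrad r σ).symm ▸ hd σ r) ?_ ?_ ?_
  · exact hgc.comp (continuous_id.prodMk continuous_const)
  · exact hsupp _ (hnot _ fun h => lt_irrefl _ h.1) σ hσ
  · exact hsupp _ (fun h => by linarith [h.2]) σ hσ
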